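/- Let X, Y ≥ 1, let P be an X×X row-stochastic TP2 transition matrix, let B be an X×Y row-stochastic observation matrix, let c₁ ∈ ℝ^X be nondecreasing, let c₂ ∈ ℝ^X be nonincreasing, and fix an observation y ∈ {1,…,Y}. Let π, π̄ be probability vectors on {1,…,X} with π̄ ≥_r π, and assume Σ_j B(j,y)·(P'π)(j) > 0 and Σ_j B(j,y)·(P'π̄)(j) > 0, where (P'π)(i) = Σ_j P(j,i)·π(j). Define the posteriors η^π_y(i) = B(i,y)·(P'π)(i)/Σ_j B(j,y)·(P'π)(j) and η^π̄_y(i) analogously, and the actions a*(π,y) = 2 if CVaR_α(c₂;η^π_y) ≤ CVaR_α(c₁;η^π_y) and a*(π,y) = 1 otherwise (similarly for π̄). If α ∈ (0,1] satisfies α ≥ 1 − η^π_y(X), then a*(π,y) = 2 implies a*(π̄,y) = 2; that is, the agent's action is monotone increasing in the prior belief with respect to the monotone likelihood ratio order. -/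

import Mathlib

open Finset

/-- `hfun π c α z = z + (1/α) · ∑ i, π i · max (c i − z) 0`. -/
noncomputable def hfun {X : ℕ} (π c : Fin X → ℝ) (α z : ℝ) : ℝ :=
  z + (1 / α) * ∑ i, π i * max (c i - z) 0

/-- `CVaR_α(c; π) = inf_z hfun π c α z`. -/
noncomputable def CVaR {X : ℕ} (π c : Fin X → ℝ) (α : ℝ) : ℝ :=
  ⨅ z : ℝ, hfun π c α z

/-- Predicted belief: `(P'π)(i) = ∑ j, P j i · π j`. -/
noncomputable def pred {X : ℕ} (P : Fin X → Fin X → ℝ) (π : Fin X → ℝ) (i : Fin X) : ℝ :=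
  ∑ j, P j i * π j

/-- Bayesian posterior after observation `y`, from prior `π` predicted through `P`:
`η^π_y(i) = B i y · (P'π)(i) / ∑ j, B j y · (P'π)(j)`. -/
noncomputable def postP {X Y : ℕ} (P : Fin X → Fin X → ℝ) (B : Fin X → Fin Y → ℝ)
    (π : Fin X → ℝ) (y : Fin Y) (i : Fin X) : ℝ :=
  B i y * pred P π i / ∑ j, B j y * pred P π j

/-- A Cauchy–Binet type inequality: if `b` is MLR-larger than `a` and `q` is MLR-larger than `p`,
then the `2 × 2` determinant of pairings is nonnegative. -/
theorem sum_mul_sum_le_of_mlr {ι : Type*} [Fintype ι] [LinearOrder ι] {a b p q : ι → ℝ}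
    (hab : ∀ k l, k < l → a l * b k ≤ a k * b l)
    (hpq : ∀ k l, k < l → q k * p l ≤ p k * q l) :
    (∑ k, a k * q k) * ∑ l, b l * p l ≤ (∑ k, a k * p k) * ∑ l, b l * q l := by
  have hnonneg : 0 ≤ ∑ k, ∑ l, (a k * b l - a l * b k) * (p k * q l - q k * p l) := by
    refine sum_nonneg fun k _ => sum_nonneg fun l _ => ?_
    rcases lt_trichotomy k l with h | h | h
    · exact mul_nonneg (sub_nonneg.2 (hab k l h)) (sub_nonneg.2 (hpq k l h))
    · subst h; simp
    · exact mul_nonneg_of_nonpos_of_nonpos (by linarith [hab l k h]) (by linarith [hpq l k h])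
  have hexpand : ∑ k, ∑ l, (a k * b l - a l * b k) * (p k * q l - q k * p l) =
      2 * ((∑ k, a k * p k) * (∑ l, b l * q l) - (∑ k, a k * q k) * ∑ l, b l * p l) := by
    have hterm : ∀ k l, (a k * b l - a l * b k) * (p k * q l - q k * p l) =
        (a k * p k) * (b l * q l) - (a k * q k) * (b l * p l)
          - (b k * p k) * (a l * q l) + (b k * q k) * (a l * p l) := fun k l => by ring
    simp only [hterm, sum_add_distrib, sum_sub_distrib, ← sum_mul_sum]
    ring
  linarith

/-- MLR dominance implies first-order stochastic dominance. -/
theorem sum_mul_le_sum_mul_of_mlr {ι : Type*} [Fintype ι] [LinearOrder ι] {p q f : ι → ℝ}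
    (hp : ∑ i, p i = 1) (hq : ∑ i, q i = 1)
    (hpq : ∀ k l, k < l → q k * p l ≤ p k * q l) (hf : Monotone f) :
    ∑ i, p i * f i ≤ ∑ i, q i * f i := by
  have h := sum_mul_sum_le_of_mlr (a := fun _ => 1) (b := f)
    (fun k l hkl => by simpa using hf hkl.le) hpq
  simpa [hp, hq, mul_comm] using h

theorem bddBelow_range_hfun {X : ℕ} {p : Fin X → ℝ} (hp0 : ∀ i, 0 ≤ p i) (hp : ∑ i, p i = 1)
    (c : Fin X → ℝ) {α : ℝ} (hα : α ∈ Set.Ioc (0 : ℝ) 1) :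
    BddBelow (Set.range (hfun p c α)) := by
  refine ⟨∑ i, p i * c i, ?_⟩
  rintro _ ⟨z, rfl⟩
  have hnonneg : 0 ≤ ∑ i, p i * max (c i - z) 0 :=
    sum_nonneg fun i _ => mul_nonneg (hp0 i) (le_max_right _ _)
  have hmean : ∑ i, p i * c i - z ≤ ∑ i, p i * max (c i - z) 0 := by
    calc ∑ i, p i * c i - z = ∑ i, p i * (c i - z) := by
          simp [mul_sub, sum_sub_distrib, ← sum_mul, hp]
      _ ≤ _ := sum_le_sum fun i _ => mul_le_mul_of_nonneg_left (le_max_left _ _) (hp0 i)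
  have hscale := le_mul_of_one_le_left hnonneg (one_le_one_div hα.1 hα.2)
  simp only [hfun]
  linarith

theorem CVaR_le_CVaR_of_monotone {X : ℕ} {p q c : Fin X → ℝ} {α : ℝ}
    (hp0 : ∀ i, 0 ≤ p i) (hp : ∑ i, p i = 1) (hq : ∑ i, q i = 1)
    (hpq : ∀ k l, k < l → q k * p l ≤ p k * q l) (hα : α ∈ Set.Ioc (0 : ℝ) 1)
    (hc : Monotone c) : CVaR p c α ≤ CVaR q c α := by
  refine ciInf_mono (bddBelow_range_hfun hp0 hp c hα) fun z => ?_
  have h := sum_mul_le_sum_mul_of_mlr (f := fun i => max (c i - z) 0) hp hq hpq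
    fun i j hij => max_le_max (sub_le_sub_right (hc hij) z) le_rfl
  exact add_le_add_right (mul_le_mul_of_nonneg_left h (one_div_nonneg.2 hα.1.le)) z

theorem CVaR_le_CVaR_of_antitone {X : ℕ} {p q c : Fin X → ℝ} {α : ℝ}
    (hq0 : ∀ i, 0 ≤ q i) (hp : ∑ i, p i = 1) (hq : ∑ i, q i = 1)
    (hpq : ∀ k l, k < l → q k * p l ≤ p k * q l) (hα : α ∈ Set.Ioc (0 : ℝ) 1)
    (hc : Antitone c) : CVaR q c α ≤ CVaR p c α := by
  refine ciInf_mono (bddBelow_range_hfun hq0 hq c hα) fun z => ?_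
  have h := sum_mul_le_sum_mul_of_mlr (f := fun i => -max (c i - z) 0) hp hq hpq
    fun i j hij => neg_le_neg (max_le_max (sub_le_sub_right (hc hij) z) le_rfl)
  simp only [mul_neg, sum_neg_distrib, neg_le_neg_iff] at h
  exact add_le_add_right (mul_le_mul_of_nonneg_left h (one_div_nonneg.2 hα.1.le)) z

theorem pred_nonneg {X : ℕ} {P : Fin X → Fin X → ℝ} (hP : ∀ i j, 0 ≤ P i j)
    {π : Fin X → ℝ} (hπ : ∀ i, 0 ≤ π i) (i : Fin X) : 0 ≤ pred P π i :=
  sum_nonneg fun j _ => mul_nonneg (hP j i) (hπ j)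

/-- Prediction through a TP2 matrix preserves the MLR order. -/
theorem pred_mlr {X : ℕ} {P : Fin X → Fin X → ℝ}
    (hP : ∀ (i i' j j' : Fin X), i ≤ i' → j ≤ j' → P i j' * P i' j ≤ P i j * P i' j')
    {p q : Fin X → ℝ} (hpq : ∀ k l, k < l → q k * p l ≤ p k * q l) (i j : Fin X) (hij : i < j) :
    pred P q i * pred P p j ≤ pred P p i * pred P q j :=
  sum_mul_sum_le_of_mlr (fun k l hkl => by linarith [hP k l i j hkl.le hij.le]) hpq

section Posterior

variable {X Y : ℕ} {P : Fin X → Fin X → ℝ} {B : Fin X → Fin Y → ℝ} {y : Fin Y}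

theorem postP_nonneg (hP : ∀ i j, 0 ≤ P i j) (hB : ∀ i y, 0 ≤ B i y)
    {π : Fin X → ℝ} (hπ : ∀ i, 0 ≤ π i) (i : Fin X) : 0 ≤ postP P B π y i :=
  div_nonneg (mul_nonneg (hB i y) (pred_nonneg hP hπ i))
    (sum_nonneg fun j _ => mul_nonneg (hB j y) (pred_nonneg hP hπ j))

theorem sum_postP {π : Fin X → ℝ} (h : 0 < ∑ j, B j y * pred P π j) :
    ∑ i, postP P B π y i = 1 := by
  simp only [postP]
  rw [← sum_div, div_self h.ne']

/-- Bayesian updating preserves the MLR order. -/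
theorem postP_mlr (hB : ∀ i y, 0 ≤ B i y) {p q : Fin X → ℝ}
    (hp : 0 < ∑ j, B j y * pred P p j) (hq : 0 < ∑ j, B j y * pred P q j)
    (hpq : ∀ i j, i < j → pred P q i * pred P p j ≤ pred P p i * pred P q j)
    (i j : Fin X) (hij : i < j) :
    postP P B q y i * postP P B p y j ≤ postP P B p y i * postP P B q y j := by
  simp only [postP, div_mul_div_comm]
  rw [mul_comm (∑ j, B j y * pred P q j)]
  refine div_le_div_of_nonneg_right ?_ (mul_pos hp hq).le
  rw [mul_mul_mul_comm, mul_mul_mul_comm (B i y) (pred P p i)]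
  exact mul_le_mul_of_nonneg_left (hpq i j hij) (mul_nonneg (hB i y) (hB j y))

end Posterior

/-- The risk-averse agent's CVaR-optimal action is monotone increasing in the prior
belief with respect to the MLR order: if the agent sells (action 2) under prior `π`
and `π̄ ≥_r π`, it also sells under `π̄`. -/
theorem action_monotone_in_prior (X Y : ℕ) (hX : 1 ≤ X) (hY : 1 ≤ Y)
    (P : Fin X → Fin X → ℝ)
    (hP0 : ∀ i j, 0 ≤ P i j) (hProw : ∀ i, ∑ j, P i j = 1)
    (hPTP2 : ∀ (i i' j j' : Fin X), i ≤ i' → j ≤ j' →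
      P i j' * P i' j ≤ P i j * P i' j')
    (B : Fin X → Fin Y → ℝ) (hB0 : ∀ i y, 0 ≤ B i y)
    (hBrow : ∀ i, ∑ y, B i y = 1)
    (c₁ c₂ : Fin X → ℝ) (hc₁ : Monotone c₁) (hc₂ : Antitone c₂)
    (y : Fin Y)
    (π πb : Fin X → ℝ)
    (hπ0 : ∀ i, 0 ≤ π i) (hπ1 : ∑ i, π i = 1)
    (hπb0 : ∀ i, 0 ≤ πb i) (hπb1 : ∑ i, πb i = 1)
    (hmlr : ∀ i j : Fin X, i < j → πb i * π j ≤ π i * πb j)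
    (hden : 0 < ∑ j, B j y * pred P π j)
    (hdenb : 0 < ∑ j, B j y * pred P πb j)
    (α : ℝ) (hα : α ∈ Set.Ioc (0 : ℝ) 1)
    (hαbig : 1 - postP P B π y ⟨X - 1, by omega⟩ ≤ α)
    (hact : CVaR (postP P B π y) c₂ α ≤ CVaR (postP P B π y) c₁ α) :
    CVaR (postP P B πb y) c₂ α ≤ CVaR (postP P B πb y) c₁ α := by
  have hpost := postP_mlr hB0 hden hdenb (pred_mlr hPTP2 hmlr)
  have hsum := sum_postP hden
  have hsumb := sum_postP hdenb
  calc CVaR (postP P B πb y) c₂ α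
      ≤ CVaR (postP P B π y) c₂ α :=
        CVaR_le_CVaR_of_antitone (postP_nonneg hP0 hB0 hπb0) hsum hsumb hpost hα hc₂
    _ ≤ CVaR (postP P B π y) c₁ α := hact
    _ ≤ CVaR (postP P B πb y) c₁ α :=
        CVaR_le_CVaR_of_monotone (postP_nonneg hP0 hB0 hπ0) hsum hsumb hpost hα hc₁
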